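/- Let L > 0, let f : [0,1] → ℝ be a measurable probability density on [0,1] (i.e. f ≥ 0 almost everywhere and ∫₀¹ f(v) dv = 1) satisfying f(v) ≤ L for almost every v ∈ [0,1], and let g : [0,1] × [0,1] → [0,1] be measurable such that for every fixed v ∈ [0,1] the map γ ↦ g(γ,v) is weakly increasing on [0,1]. Define U(γ) = ∫_{γ}^{1} g(γ,v) f(v) dv. Then U is L-left-Lipschitz: for all 0 ≤ γ₁ ≤ γ₂ ≤ 1, U(γ₂) − U(γ₁) ≥ −L(γ₂ − γ₁). -/

import Mathlib

open MeasureTheory Set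

/-- With a monotone reward function `g` and a value distribution given by a density `f`
bounded by `L`, the expected utility `U(γ) = ∫_γ^1 g(γ,v) f(v) dv` is `L`-left-Lipschitz. -/
theorem stmt_0 (L : ℝ) (hL : 0 < L) (f : ℝ → ℝ) (g : ℝ → ℝ → ℝ)
    (hf_meas : Measurable f)
    (hf_nonneg : ∀ᵐ v ∂(volume.restrict (Icc (0:ℝ) 1)), 0 ≤ f v)
    (hf_bound : ∀ᵐ v ∂(volume.restrict (Icc (0:ℝ) 1)), f v ≤ L)
    (hf_int : ∫ v in (0:ℝ)..1, f v = 1)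
    (hg_meas : Measurable (Function.uncurry g))
    (hg_range : ∀ γ ∈ Icc (0:ℝ) 1, ∀ v ∈ Icc (0:ℝ) 1, g γ v ∈ Icc (0:ℝ) 1)
    (hg_mono : ∀ v ∈ Icc (0:ℝ) 1, ∀ γ₁ γ₂, 0 ≤ γ₁ → γ₁ ≤ γ₂ → γ₂ ≤ 1 →
      g γ₁ v ≤ g γ₂ v)
    (U : ℝ → ℝ)
    (hU : ∀ γ, U γ = ∫ v in γ..1, g γ v * f v) :
    ∀ γ₁ γ₂, 0 ≤ γ₁ → γ₁ ≤ γ₂ → γ₂ ≤ 1 →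
      U γ₂ - U γ₁ ≥ -L * (γ₂ - γ₁) := by
  have hbound : ∀ γ ∈ Icc (0:ℝ) 1, ∀ᵐ v ∂(volume.restrict (Icc (0:ℝ) 1)),
      0 ≤ g γ v * f v ∧ g γ v * f v ≤ L := by
    intro γ hγ
    filter_upwards [hf_nonneg, hf_bound, ae_restrict_mem measurableSet_Icc] with v h0 hL' hv
    obtain ⟨hg0, hg1⟩ := hg_range γ hγ v hv
    exact ⟨mul_nonneg hg0 h0, (mul_le_of_le_one_left h0 hg1).trans hL'⟩
  have hint : ∀ γ ∈ Icc (0:ℝ) 1, IntegrableOn (fun v => g γ v * f v) (Icc (0:ℝ) 1) := by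
    intro γ hγ
    refine Measure.integrableOn_of_bounded (M := L) (by simp)
      ((hg_meas.of_uncurry_left.mul hf_meas).aestronglyMeasurable) ?_
    filter_upwards [hbound γ hγ] with v hv
    rw [Real.norm_of_nonneg hv.1]
    exact hv.2
  have hii : ∀ γ ∈ Icc (0:ℝ) 1, ∀ a b : ℝ, 0 ≤ a → a ≤ b → b ≤ 1 →
      IntervalIntegrable (fun v => g γ v * f v) volume a b := by
    intro γ hγ a b ha hab hb
    refine ((hint γ hγ).mono_set ?_).intervalIntegrable
    rw [uIcc_of_le hab]
    exact Icc_subset_Icc ha hb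
  intro γ₁ γ₂ h0 h12 h1
  have hγ₁ : γ₁ ∈ Icc (0:ℝ) 1 := ⟨h0, h12.trans h1⟩
  have hγ₂ : γ₂ ∈ Icc (0:ℝ) 1 := ⟨h0.trans h12, h1⟩
  have hleft : ∫ v in γ₁..γ₂, g γ₁ v * f v ≤ L * (γ₂ - γ₁) := by
    have hle : ∫ v in γ₁..γ₂, g γ₁ v * f v ≤ ∫ _ in γ₁..γ₂, L := by
      refine intervalIntegral.integral_mono_ae_restrict h12 (hii γ₁ hγ₁ _ _ h0 h12 h1)
        intervalIntegrable_const ?_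
      filter_upwards [ae_restrict_of_ae_restrict_of_subset (Icc_subset_Icc h0 h1)
        (hbound γ₁ hγ₁)] with v hv
      exact hv.2
    rwa [intervalIntegral.integral_const, smul_eq_mul, mul_comm] at hle
  have hright : ∫ v in γ₂..1, g γ₁ v * f v ≤ ∫ v in γ₂..1, g γ₂ v * f v := by
    refine intervalIntegral.integral_mono_ae_restrict h1 (hii γ₁ hγ₁ _ _ hγ₂.1 h1 le_rfl)
      (hii γ₂ hγ₂ _ _ hγ₂.1 h1 le_rfl) ?_
    have hsub : Icc γ₂ 1 ⊆ Icc (0:ℝ) 1 := Icc_subset_Icc_left hγ₂.1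
    filter_upwards [ae_restrict_of_ae_restrict_of_subset hsub hf_nonneg,
      ae_restrict_mem measurableSet_Icc] with v hv hmem
    exact mul_le_mul_of_nonneg_right (hg_mono v (hsub hmem) γ₁ γ₂ h0 h12 h1) hv
  have hsplit := intervalIntegral.integral_add_adjacent_intervals
    (hii γ₁ hγ₁ _ _ h0 h12 h1) (hii γ₁ hγ₁ _ _ hγ₂.1 h1 le_rfl)
  rw [hU γ₁, hU γ₂]
  linarith
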